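/- Let h : L → K be a homomorphism of bounded distributive lattices and let p be a prime filter on L. The following are equivalent: (1) there exists a prime filter u on K such that the preimage of u under h equals p and u is somewhere dense, i.e. there is a ∈ K with a ≠ ⊥ such that every prime filter of K containing a is contained in u; (2) there exists a ∈ K such that (i) for every φ ∈ L, φ ∈ p if and only if h(φ) ⊓ a ≠ ⊥, and (ii) whenever b₁ ≤ a and b₂ ≤ a with b₁ ⊓ b₂ = ⊥, then b₁ = ⊥ or b₂ = ⊥. -/

import Mathlib

namespace PosModel

/-- A *prime filter* on a bounded distributive lattice: a proper filter `p`
(upward closed, closed under finite meets, containing `⊤` and not `⊥`) such that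
`a ⊔ b ∈ p` implies `a ∈ p` or `b ∈ p`. -/
structure IsPrimeFilter {L : Type*} [DistribLattice L] [BoundedOrder L] (p : Set L) : Prop where
  top_mem : ⊤ ∈ p
  bot_not_mem : ⊥ ∉ p
  mem_of_le : ∀ ⦃a b : L⦄, a ∈ p → a ≤ b → b ∈ p
  inf_mem : ∀ ⦃a b : L⦄, a ∈ p → b ∈ p → a ⊓ b ∈ p
  prime : ∀ ⦃a b : L⦄, a ⊔ b ∈ p → a ∈ p ∨ b ∈ p

/-- Every nonzero element of a bounded distributive lattice lies in a prime filter. -/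
theorem exists_isPrimeFilter_mem {K : Type*} [DistribLattice K] [BoundedOrder K] {b : K}
    (hb : b ≠ ⊥) : ∃ q : Set K, IsPrimeFilter q ∧ b ∈ q := by
  have hdisj : Disjoint (Order.PFilter.principal b : Set K) (Order.Ideal.principal (⊥ : K)) := by
    rw [Set.disjoint_left]
    intro x hx hx'
    exact hb (le_bot_iff.1 ((Order.PFilter.mem_principal.1 hx).trans
      (Order.Ideal.mem_principal.1 hx')))
  obtain ⟨J, hJ, -, hFJ⟩ := DistribLattice.prime_ideal_of_disjoint_filter_ideal hdisj
  refine ⟨(J : Set K)ᶜ, ⟨?_, ?_, ?_, ?_, ?_⟩, ?_⟩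
  · exact hJ.toIsProper.top_notMem
  · exact fun hbot => hbot J.bot_mem
  · exact fun x y hx hxy hy => hx (J.lower hxy hy)
  · exact fun x y hx hy hxy => (hJ.mem_or_mem hxy).elim hx hy
  · intro x y hxy
    by_contra! hcon
    exact hxy (Order.Ideal.sup_mem (not_not.1 hcon.1) (not_not.1 hcon.2))
  · exact Set.disjoint_left.1 hFJ (Order.PFilter.mem_principal.2 le_rfl)

/-- If `a ≠ ⊥` and any two nonzero elements below `a` meet, then the elements meeting `a`
form a prime filter. -/
theorem isPrimeFilter_setOf_inf_ne_bot {K : Type*} [DistribLattice K] [BoundedOrder K] {a : K}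
    (ha : a ≠ ⊥)
    (hirr : ∀ b₁ b₂ : K, b₁ ≤ a → b₂ ≤ a → b₁ ⊓ b₂ = ⊥ → b₁ = ⊥ ∨ b₂ = ⊥) :
    IsPrimeFilter {b : K | b ⊓ a ≠ ⊥} where
  top_mem := by simpa using ha
  bot_not_mem := by simp
  mem_of_le _ _ hx hxy := ne_bot_of_le_ne_bot hx (inf_le_inf_right a hxy)
  inf_mem x y hx hy hxy := by
    rw [inf_inf_distrib_right] at hxy
    exact (hirr _ _ inf_le_right inf_le_right hxy).elim hx hy
  prime x y hxy := by
    by_contra! hcon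
    simp only [Set.mem_ofPred_eq, not_not] at hcon hxy
    exact hxy (by rw [inf_sup_right, hcon.1, hcon.2, sup_bot_eq])

/-- Criterion for a prime filter `p` on `L` to be *realized* along a bounded
lattice homomorphism `h : L → K`: there is a somewhere dense prime filter `u`
on `K` pulling back to `p` iff there is an element `a : K` such that
`φ ∈ p ↔ h φ ⊓ a ≠ ⊥` and any two disjoint elements below `a` cannot both be
nonzero. -/
theorem realized_iff {L K : Type*} [DistribLattice L] [BoundedOrder L]
    [DistribLattice K] [BoundedOrder K] (h : BoundedLatticeHom L K)
    (p : Set L) (hp : IsPrimeFilter p) :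
    (∃ u : Set K, IsPrimeFilter u ∧ {φ : L | h φ ∈ u} = p ∧
        ∃ a : K, a ≠ ⊥ ∧ ∀ q : Set K, IsPrimeFilter q → a ∈ q → q ⊆ u) ↔
      (∃ a : K, (∀ φ : L, φ ∈ p ↔ h φ ⊓ a ≠ ⊥) ∧
        ∀ b₁ b₂ : K, b₁ ≤ a → b₂ ≤ a → b₁ ⊓ b₂ = ⊥ → b₁ = ⊥ ∨ b₂ = ⊥) := by
  constructor
  · rintro ⟨u, hu, rfl, a, ha, hau⟩
    have mem_of_le : ∀ b ≤ a, b ≠ ⊥ → b ∈ u := fun b hba hb => by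
      obtain ⟨q, hq, hbq⟩ := exists_isPrimeFilter_mem hb
      exact hau q hq (hq.mem_of_le hbq hba) hbq
    have ne_bot : ∀ {b : K}, b ∈ u → b ≠ ⊥ := fun hb => ne_of_mem_of_not_mem hb hu.bot_not_mem
    refine ⟨a, fun φ => ⟨fun hφ => ne_bot (hu.inf_mem hφ (mem_of_le a le_rfl ha)),
      fun hφ => hu.mem_of_le (mem_of_le _ inf_le_right hφ) inf_le_left⟩, ?_⟩
    intro b₁ b₂ h₁ h₂ hbot
    by_contra! hcon
    exact ne_bot (hu.inf_mem (mem_of_le b₁ h₁ hcon.1) (mem_of_le b₂ h₂ hcon.2)) hbot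
  · rintro ⟨a, hpa, hirr⟩
    have ha : a ≠ ⊥ := by simpa using (hpa ⊤).1 hp.top_mem
    exact ⟨_, isPrimeFilter_setOf_inf_ne_bot ha hirr, Set.ext fun φ => (hpa φ).symm, a, ha,
      fun q hq haq b hb => ne_of_mem_of_not_mem (hq.inf_mem hb haq) hq.bot_not_mem⟩

end PosModel
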